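/- (Gamma weights, relation (3.13).) Let m > 0 and θ > 0 and take the gamma weight moments V_j = θ^j·m·(m+1)⋯(m+j−1) for j ≥ 1 (the moments of the gamma law with shape m and scale θ), so that H(u) = (1 − θu)^{−m} for u ∈ [0, 1/θ). Let χ > 0, let u ∈ (0, 1/θ) be the solution of m·θ·u/(1 − θu)^{m+1} = 1/χ, and set x_k = χ·k. Then M_k(x_k) · √( (1 + m·θ·u)/(1 − θ·u) ) / ( (k/(e·u)) · exp( (1 − θu)·(1 − (1 − θu)^m)/(m·θ·u) ) )^k → 1 as k → ∞. -/

import Mathlib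

open scoped BigOperators ENNReal
open Filter MeasureTheory

noncomputable section

/-- The finset of tuples `(l 0, ..., l (k-1))` (representing `l_1, ..., l_k`) of nonnegative
integers with `l_1 + 2 l_2 + ⋯ + k l_k = k`. -/
def bellTuples (k : ℕ) : Finset (Fin k → ℕ) :=
  (Fintype.piFinset fun _ => Finset.range (k + 1)).filter
    (fun l => ∑ i, (i.1 + 1) * l i = k)

/-- Weighted Bell polynomial `M_k(x)` for weights `V_1, V_2, …`. -/
def weightedBell (V : ℕ → ℝ) (k : ℕ) (x : ℝ) : ℝ :=
  (Nat.factorial k : ℝ) * ∑ l ∈ bellTuples k, ∏ i : Fin k,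
    (x * V (i.1 + 1)) ^ (l i) /
      ((Nat.factorial (i.1 + 1) : ℝ) ^ (l i) * (Nat.factorial (l i) : ℝ))

/-- Exponential generating function `H(u) = 1 + ∑_{i ≥ 1} V_i u^i / i!` of the weights. -/
def weightEGF (V : ℕ → ℝ) (u : ℝ) : ℝ :=
  1 + ∑' i : ℕ, V (i + 1) * u ^ (i + 1) / (Nat.factorial (i + 1) : ℝ)

/-- Termwise derivative `H'(u) = ∑_{i ≥ 1} V_i u^{i-1}/(i-1)!`. -/
def weightEGFDeriv (V : ℕ → ℝ) (u : ℝ) : ℝ :=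
  ∑' i : ℕ, V (i + 1) * u ^ i / (Nat.factorial i : ℝ)

/-- Termwise second derivative `H''(u)`. -/
def weightEGFDeriv2 (V : ℕ → ℝ) (u : ℝ) : ℝ :=
  ∑' i : ℕ, V (i + 2) * u ^ i / (Nat.factorial i : ℝ)

/-- `H(u) < ∞` for all `u ∈ [0, u_0)`. -/
def HFinite (V : ℕ → ℝ) (u0 : ℝ≥0∞) : Prop :=
  ∀ u : ℝ, 0 ≤ u → ENNReal.ofReal u < u0 →
    Summable (fun i : ℕ => V (i + 1) * u ^ (i + 1) / (Nat.factorial (i + 1) : ℝ))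

lemma hasSum_risingFactorial (m : ℝ) {s : ℝ} (hs : |s| < 1) :
    HasSum (fun n : ℕ => (∏ i ∈ Finset.range n, (m + i)) * s ^ n / (Nat.factorial n : ℝ))
      ((1 - s) ^ (-m)) := by
  have h := (Real.one_div_one_sub_rpow_hasFPowerSeriesOnBall_zero m).hasSum
    (y := s) (by simpa [enorm_eq_nnnorm, ← NNReal.coe_lt_coe] using hs)
  have h1 : (0 : ℝ) ≤ 1 - s := by linarith [(abs_lt.1 hs).2]
  simp only [zero_add, one_div, ← Real.rpow_neg h1] at h
  convert! h using 1
  ext n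
  have h2 : (Nat.factorial n : ℝ) * Ring.choose (m + n - 1) n =
      ∏ i ∈ Finset.range n, (m + i) := by
    rw [← Ring.multichoose_eq, ← nsmul_eq_mul, Ring.factorial_nsmul_multichoose_eq_ascPochhammer,
      Polynomial.ascPochhammer_smeval_eq_eval]
    induction n with
    | zero => simp
    | succ n ih => rw [ascPochhammer_succ_eval, ih, Finset.prod_range_succ]
  rw [← h2]
  have := Nat.cast_ne_zero (R := ℝ) |>.2 (Nat.factorial_ne_zero n)
  simp [FormalMultilinearSeries.ofScalars]
  field_simp

lemma summable_and_hasSum_prod_fin {N : ℕ} (f : Fin N → ℕ → ℂ)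
    (hf : ∀ i, Summable fun n => ‖f i n‖) :
    (Summable fun l : Fin N → ℕ => ‖∏ i, f i (l i)‖) ∧
      HasSum (fun l : Fin N → ℕ => ∏ i, f i (l i)) (∏ i, ∑' n, f i n) := by
  induction N with
  | zero =>
    refine ⟨Summable.of_finite, ?_⟩
    simp
  | succ N ih =>
    obtain ⟨ih1, ih2⟩ := ih (fun i => f i.succ) (fun i => hf i.succ)
    let g : (Fin N → ℕ) → ℂ := fun l => ∏ i : Fin N, f i.succ (l i)
    rw [← (Fin.consEquiv fun _ => ℕ).summable_iff, ← (Fin.consEquiv fun _ => ℕ).hasSum_iff]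
    have key : (fun l : Fin (N + 1) → ℕ => ∏ i, f i (l i)) ∘ (Fin.consEquiv fun _ => ℕ) =
        fun p : ℕ × (Fin N → ℕ) => f 0 p.1 * g p.2 := by
      ext p
      simp [Fin.prod_univ_succ, Fin.consEquiv, g]
    have key' : (fun l : Fin (N + 1) → ℕ => ‖∏ i, f i (l i)‖) ∘ (Fin.consEquiv fun _ => ℕ) =
        fun p : ℕ × (Fin N → ℕ) => ‖f 0 p.1 * g p.2‖ := by
      ext p
      exact congrArg norm (congrFun key p)
    refine ⟨?_, ?_⟩
    · rw [key']
      exact Summable.mul_norm (f := f 0) (g := g) (hf 0) ih1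
    · rw [key, Fin.prod_univ_succ]
      exact HasSum.mul (f := f 0) (g := g) (hf 0).of_norm.hasSum ih2
        (summable_mul_of_summable_norm (f := f 0) (g := g) (hf 0) ih1)

lemma integral_exp_int_mul_I (n : ℤ) :
    ∫ φ in (-Real.pi)..Real.pi, Complex.exp (n * φ * Complex.I) =
      if n = 0 then 2 * (Real.pi : ℂ) else 0 := by
  split_ifs with h
  · simp [h]; ring
  · have hc : (n : ℂ) * Complex.I ≠ 0 := by simp [h]
    have h1 := integral_exp_mul_complex (a := -Real.pi) (b := Real.pi) hc
    have h2 : Complex.exp (n * Complex.I * Real.pi) =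
        Complex.exp (n * Complex.I * (-Real.pi : ℝ)) := by
      rw [Complex.exp_eq_exp_iff_exists_int]
      exact ⟨n, by push_cast; ring⟩
    rw [h2, sub_self, zero_div] at h1
    rw [← h1]
    congr 1
    ext φ
    ring_nf

lemma integral_exp_sum_eq_sum_bellTuples (k : ℕ) (b : Fin k → ℂ) :
    ∫ φ in (-Real.pi)..Real.pi,
        Complex.exp (∑ i, b i * Complex.exp ((i.1 + 1 : ℕ) * φ * Complex.I) -
          k * φ * Complex.I) =
      2 * Real.pi * ∑ l ∈ bellTuples k, ∏ i, b i ^ l i / (Nat.factorial (l i) : ℂ) := by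
  have hexp (z : ℂ) : HasSum (fun n : ℕ => z ^ n / (Nat.factorial n : ℂ)) (Complex.exp z) := by
    rw [Complex.exp_eq_exp_ℂ]
    exact NormedSpace.expSeries_div_hasSum_exp z
  have hterm (l : Fin k → ℕ) (φ : ℝ) :
      (∏ i, (b i * Complex.exp ((i.1 + 1 : ℕ) * φ * Complex.I)) ^ l i /
          (Nat.factorial (l i) : ℂ)) * Complex.exp (-(k * φ * Complex.I)) =
        (∏ i, b i ^ l i / (Nat.factorial (l i) : ℂ)) *
          Complex.exp (((∑ i, (i.1 + 1) * l i : ℕ) - k : ℤ) * φ * Complex.I) := by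
    have : ∏ i : Fin k, Complex.exp ((i.1 + 1 : ℕ) * φ * Complex.I) ^ l i =
        Complex.exp ((∑ i : Fin k, (i.1 + 1) * l i : ℕ) * φ * Complex.I) := by
      simp_rw [← Complex.exp_nat_mul]
      rw [← Complex.exp_sum]
      congr 1
      push_cast
      rw [Finset.sum_mul, Finset.sum_mul]
      exact Finset.sum_congr rfl fun i _ => by ring
    simp_rw [mul_pow, mul_div_right_comm]
    rw [Finset.prod_mul_distrib, this, mul_assoc, ← Complex.exp_add]
    congr 2
    push_cast
    ring
  have hsum : Summable fun l : Fin k → ℕ => ‖∏ i, b i ^ l i / (Nat.factorial (l i) : ℂ)‖ :=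
    (summable_and_hasSum_prod_fin (fun i n => b i ^ n / (Nat.factorial n : ℂ))
      fun i => (hexp (b i)).summable.norm).1
  have hint : HasSum (fun l : Fin k → ℕ => ∫ φ in (-Real.pi)..Real.pi,
      (∏ i, b i ^ l i / (Nat.factorial (l i) : ℂ)) *
          Complex.exp (((∑ i, (i.1 + 1) * l i : ℕ) - k : ℤ) * φ * Complex.I))
      (∫ φ in (-Real.pi)..Real.pi,
        Complex.exp (∑ i, b i * Complex.exp ((i.1 + 1 : ℕ) * φ * Complex.I) -
          k * φ * Complex.I)) := by
    refine intervalIntegral.hasSum_integral_of_dominated_convergence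
      (fun l _ => ‖∏ i, b i ^ l i / (Nat.factorial (l i) : ℂ)‖) (fun l => ?_) (fun l => ?_)
      (ae_of_all _ fun _ _ => hsum) (by simp) (ae_of_all _ fun φ _ => ?_)
    · exact Continuous.aestronglyMeasurable (by fun_prop)
    · refine ae_of_all _ fun φ _ => ?_
      rw [norm_mul]
      have := Complex.norm_exp_ofReal_mul_I ((((∑ i, (i.1 + 1) * l i : ℕ) - k : ℤ) : ℝ) * φ)
      push_cast at this ⊢
      rw [this, mul_one]
    · simp_rw [← hterm]
      rw [sub_eq_add_neg, Complex.exp_add, Complex.exp_sum]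
      refine HasSum.mul_right _ ?_
      have := (summable_and_hasSum_prod_fin
        (fun i n => (b i * Complex.exp ((i.1 + 1 : ℕ) * φ * Complex.I)) ^ n /
          (Nat.factorial n : ℂ)) fun i => (hexp _).summable.norm).2
      simpa only [(hexp _).tsum_eq] using this
  refine hint.unique ?_
  simp_rw [intervalIntegral.integral_const_mul, integral_exp_int_mul_I]
  rw [Finset.mul_sum]
  have hmem (l : Fin k → ℕ) :
      l ∈ bellTuples k ↔ ((∑ i, (i.1 + 1) * l i : ℕ) - k : ℤ) = 0 := by
    rw [sub_eq_zero, Nat.cast_inj, bellTuples, Finset.mem_filter, Fintype.mem_piFinset]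
    refine and_iff_right_of_imp fun h i => Finset.mem_range_succ_iff.2 ?_
    calc l i ≤ (i.1 + 1) * l i := Nat.le_mul_of_pos_left _ (Nat.succ_pos _)
      _ ≤ ∑ i : Fin k, (i.1 + 1) * l i :=
        Finset.single_le_sum (f := fun i : Fin k => (i.1 + 1) * l i)
          (fun _ _ => Nat.zero_le _) (Finset.mem_univ i)
      _ = k := h
  convert hasSum_sum_of_ne_finset_zero (s := bellTuples k) ?_ using 1
  · refine Finset.sum_congr rfl fun l hl => ?_
    rw [if_pos ((hmem l).1 hl), mul_comm]
  · intro l hl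
    rw [if_neg (mt (hmem l).2 hl), mul_zero]
  · infer_instance

/-- The exponent of the integrand in the saddle point integral. -/
def saddleExponent (a : ℕ → ℝ) (A : ℝ) (k : ℕ) (φ : ℝ) : ℂ :=
  ∑ i ∈ Finset.range k, (k * a i : ℂ) * Complex.exp ((i + 1 : ℕ) * φ * Complex.I) -
    k * φ * Complex.I - k * A

lemma norm_exp_saddleExponent_le {a : ℕ → ℝ} {A : ℝ} (ha : ∀ i, 0 ≤ a i) (hA : HasSum a A)
    {k : ℕ} (hk : 0 < k) {φ : ℝ} (hφ : |φ| ≤ Real.pi) :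
    ‖Complex.exp (saddleExponent a A k φ)‖ ≤
      Real.exp (-(2 / Real.pi ^ 2 * a 0) * (k * φ ^ 2)) := by
  rw [Complex.norm_exp, Real.exp_le_exp]
  have hre : (saddleExponent a A k φ).re =
      ∑ i ∈ Finset.range k, k * a i * Real.cos ((i + 1 : ℕ) * φ) - k * A := by
    have hcos (i : ℕ) : ((k * a i : ℂ) * Complex.exp ((i + 1 : ℕ) * φ * Complex.I)).re =
        k * a i * Real.cos ((i + 1 : ℕ) * φ) := by
      have := Complex.exp_ofReal_mul_I_re (((i + 1 : ℕ) : ℝ) * φ)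
      push_cast at this ⊢
      rw [← this, ← Complex.ofReal_natCast, ← Complex.ofReal_mul, Complex.re_ofReal_mul]
    simp only [saddleExponent, Complex.sub_re, Complex.re_sum, hcos]
    simp
  have hle : ∑ i ∈ Finset.range k, a i ≤ A := sum_le_hasSum _ (fun i _ => ha i) hA
  have hk0 : (0 : ℝ) ≤ k := k.cast_nonneg
  obtain ⟨n, rfl⟩ : ∃ n, k = n + 1 := ⟨k - 1, by omega⟩
  have hs : ∑ i ∈ Finset.range n, ((n + 1 : ℕ) : ℝ) * a (i + 1) *
      Real.cos ((i + 1 + 1 : ℕ) * φ) ≤ (n + 1 : ℕ) * ∑ i ∈ Finset.range n, a (i + 1) := by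
    rw [Finset.mul_sum]
    exact Finset.sum_le_sum fun i _ =>
      mul_le_of_le_one_right (mul_nonneg hk0 (ha _)) (Real.cos_le_one _)
  rw [Finset.sum_range_succ'] at hle
  rw [hre, Finset.sum_range_succ']
  have hc := mul_le_mul_of_nonneg_left (Real.cos_le_one_sub_mul_cos_sq hφ)
    (mul_nonneg hk0 (ha 0))
  have hA' := mul_le_mul_of_nonneg_left hle hk0
  simp only [zero_add, Nat.cast_one, one_mul] at *
  linarith

lemma norm_exp_mul_I_sub_one_sub_le (x : ℝ) :
    ‖Complex.exp (x * Complex.I) - 1 - x * Complex.I‖ ≤ 3 * x ^ 2 := by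
  have hx : ‖(x * Complex.I : ℂ)‖ = |x| := by simp
  rcases le_or_gt |x| 1 with h | h
  · have := Complex.norm_exp_sub_one_sub_id_le (hx.trans_le h)
    rw [hx, sq_abs] at this
    nlinarith [sq_nonneg x]
  · have h1 : ‖Complex.exp (x * Complex.I) - 1 - x * Complex.I‖ ≤ 1 + 1 + |x| := by
      refine (norm_sub_le _ _).trans (add_le_add ((norm_sub_le _ _).trans_eq ?_) hx.le)
      rw [Complex.norm_exp_ofReal_mul_I, norm_one]
    nlinarith [sq_abs x]

lemma tendsto_mul_exp_div_sqrt (c : ℝ) :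
    Tendsto (fun k : ℕ => (k : ℂ) * (Complex.exp ((c / √(k : ℝ) : ℝ) * Complex.I) - 1 -
      (c / √(k : ℝ) : ℝ) * Complex.I)) atTop (nhds (-(c ^ 2 / 2 : ℝ))) := by
  have hsq : Tendsto (fun k : ℕ => √(k : ℝ)) atTop atTop :=
    Real.tendsto_sqrt_atTop.comp tendsto_natCast_atTop_atTop
  have hq : Tendsto (fun k : ℕ => |c| / √(k : ℝ)) atTop (nhds 0) := hsq.const_div_atTop _
  have hbound : Tendsto (fun k : ℕ => |c| ^ 2 * (|c| / √(k : ℝ)) * Real.exp (|c| / √(k : ℝ)))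
      atTop (nhds 0) := by
    simpa [-sq_abs] using (hq.const_mul (|c| ^ 2)).mul
      (Real.continuous_exp.continuousAt.tendsto.comp hq)
  rw [tendsto_iff_norm_sub_tendsto_zero]
  refine squeeze_zero' (Eventually.of_forall fun _ => norm_nonneg _) ?_ hbound
  filter_upwards [eventually_gt_atTop 0] with k hk
  have hk' : (0 : ℝ) < k := Nat.cast_pos.2 hk
  have hs : 0 < √(k : ℝ) := Real.sqrt_pos.2 hk'
  have hss : √(k : ℝ) ^ 2 = k := Real.sq_sqrt hk'.le
  set x : ℝ := c / √(k : ℝ) with hx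
  have hkx : (k : ℝ) * x ^ 2 = c ^ 2 := by rw [hx, div_pow, hss]; field_simp
  have habs : |x| = |c| / √(k : ℝ) := by rw [hx, abs_div, abs_of_pos hs]
  have h3 := Complex.norm_exp_sub_sum_le_norm_mul_exp (x * Complex.I) 3
  have hn : ‖(x * Complex.I : ℂ)‖ = |x| := by simp
  have hkxC : (k : ℂ) * (x : ℂ) ^ 2 = (c : ℂ) ^ 2 := by exact_mod_cast hkx
  have heq : (k : ℂ) * (Complex.exp (x * Complex.I) - 1 - x * Complex.I) -
      ((-(c ^ 2 / 2 : ℝ) : ℝ) : ℂ) = k * (Complex.exp (x * Complex.I) -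
        ∑ m ∈ Finset.range 3, (x * Complex.I) ^ m / (Nat.factorial m : ℂ)) := by
    simp only [Finset.sum_range_succ, Finset.sum_range_zero, Nat.factorial]
    push_cast
    rw [← hkxC]
    linear_combination (k * x ^ 2 / 2 : ℂ) * Complex.I_sq
  rw [hn] at h3
  push_cast at heq ⊢
  rw [heq, norm_mul, Complex.norm_natCast, ← habs]
  calc _ ≤ (k : ℝ) * (|x| ^ 3 * Real.exp |x|) := by gcongr
    _ = ((k : ℝ) * x ^ 2) * |x| * Real.exp |x| := by rw [← sq_abs x]; ring
    _ = _ := by rw [hkx, sq_abs]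

lemma tendsto_saddleExponent {a : ℕ → ℝ} {A v : ℝ} (ha : ∀ i, 0 ≤ a i) (hA : HasSum a A)
    (h1 : HasSum (fun i : ℕ => ((i + 1 : ℕ) : ℝ) * a i) 1)
    (h2 : HasSum (fun i : ℕ => ((i + 1 : ℕ) : ℝ) ^ 2 * a i) v) (t : ℝ) :
    Tendsto (fun k : ℕ => saddleExponent a A k (t / √(k : ℝ))) atTop
      (nhds ((-(v / 2) * t ^ 2 : ℝ) : ℂ)) := by
  let F : ℕ → ℕ → ℂ := fun k i => (k * a i : ℂ) *
    ((if i < k then Complex.exp ((((i + 1 : ℕ) * t) / √(k : ℝ) : ℝ) * Complex.I) else 0) - 1 -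
      (((i + 1 : ℕ) * t) / √(k : ℝ) : ℝ) * Complex.I)
  have hF (k : ℕ) : saddleExponent a A k (t / √(k : ℝ)) = ∑' i, F k i := by
    have e1 := hasSum_sum_of_ne_finset_zero (L := SummationFilter.unconditional ℕ)
      (s := Finset.range k) (f := fun i => (k * a i : ℂ) *
        if i < k then Complex.exp ((((i + 1 : ℕ) * t) / √(k : ℝ) : ℝ) * Complex.I) else 0)
      (fun i hi => by rw [if_neg (by simpa using hi), mul_zero])
    have e2 := (Complex.hasSum_ofReal.2 hA).mul_left (k : ℂ)
    have e3 := (Complex.hasSum_ofReal.2 h1).mul_left (k * (t / √(k : ℝ) : ℝ) * Complex.I : ℂ)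
    have e := (e1.sub e2).sub e3
    have := e.tsum_eq
    symm
    convert this using 1
    · refine tsum_congr fun i => ?_
      simp only [F]
      push_cast
      ring
    · rw [saddleExponent]
      have : ∀ i ∈ Finset.range k, (k * a i : ℂ) *
          (if i < k then Complex.exp ((((i + 1 : ℕ) * t) / √(k : ℝ) : ℝ) * Complex.I) else 0) =
          (k * a i : ℂ) * Complex.exp ((i + 1 : ℕ) * (t / √(k : ℝ) : ℝ) * Complex.I) := by
        intro i hi
        rw [if_pos (Finset.mem_range.1 hi)]
        push_cast
        ring_nf
      rw [Finset.sum_congr rfl this]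
      push_cast
      ring
  simp_rw [hF]
  have hv := (Complex.hasSum_ofReal.2 (h2.mul_right (-(t ^ 2 / 2)))).tsum_eq
  rw [show -(v / 2) * t ^ 2 = v * -(t ^ 2 / 2) by ring, ← hv]
  refine tendsto_tsum_of_dominated_convergence
    (bound := fun i => (3 * t ^ 2 + 1 + |t|) * (((i + 1 : ℕ) : ℝ) ^ 2 * a i))
    (h2.summable.mul_left _) (fun i => ?_) ?_
  · have h := (tendsto_mul_exp_div_sqrt ((i + 1 : ℕ) * t)).const_mul (a i : ℂ)
    rw [show (((((i + 1 : ℕ) : ℝ) ^ 2 * a i * -(t ^ 2 / 2) : ℝ)) : ℂ) =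
      (a i : ℂ) * ((-((((i + 1 : ℕ) : ℝ) * t) ^ 2 / 2) : ℝ) : ℂ) by push_cast; ring]
    push_cast at h ⊢
    refine h.congr' ?_
    filter_upwards [eventually_gt_atTop i] with k hk
    simp only [F, if_pos hk]
    push_cast
    ring
  · filter_upwards [eventually_gt_atTop 0] with k hk i
    have hk' : (0 : ℝ) < k := Nat.cast_pos.2 hk
    have hk1 : (1 : ℝ) ≤ k := by exact_mod_cast hk
    have hs : 0 < √(k : ℝ) := Real.sqrt_pos.2 hk'
    have hss : √(k : ℝ) ^ 2 = k := Real.sq_sqrt hk'.le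
    have hs1 : 1 ≤ √(k : ℝ) := Real.one_le_sqrt.2 hk1
    set j : ℝ := ((i + 1 : ℕ) : ℝ) with hj
    have hj0 : 0 < j := by positivity
    have hn : ‖(k * a i : ℂ)‖ = k * a i := by
      rw [norm_mul, Complex.norm_natCast, Complex.norm_of_nonneg (ha i)]
    have hkx : (k : ℝ) * (j * t / √(k : ℝ)) ^ 2 = j ^ 2 * t ^ 2 := by
      rw [div_pow, hss]; field_simp
    simp only [F]
    rw [norm_mul, hn]
    split_ifs with hik
    · have h := norm_exp_mul_I_sub_one_sub_le (j * t / √(k : ℝ))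
      calc _ ≤ k * a i * (3 * (j * t / √(k : ℝ)) ^ 2) :=
            mul_le_mul_of_nonneg_left h (mul_nonneg hk'.le (ha i))
        _ = 3 * t ^ 2 * (j ^ 2 * a i) := by linear_combination 3 * a i * hkx
        _ ≤ _ := by
          refine mul_le_mul_of_nonneg_right ?_ (mul_nonneg (sq_nonneg _) (ha i))
          linarith [abs_nonneg t]
    · have hkj : (k : ℝ) ≤ j := by
        rw [hj]; exact_mod_cast (not_lt.1 hik).trans (Nat.le_succ i)
      have h : ‖(0 - 1 - ((j * t / √(k : ℝ) : ℝ) : ℂ) * Complex.I)‖ ≤ 1 + j * |t| := by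
        refine (norm_sub_le _ _).trans (add_le_add (by simp) ?_)
        rw [norm_mul, Complex.norm_I, mul_one, Complex.norm_real, Real.norm_eq_abs, abs_div,
          abs_mul, abs_of_pos hj0, abs_of_pos hs]
        exact div_le_self (by positivity) hs1
      have hj1 : 1 ≤ j := hk1.trans hkj
      calc _ ≤ k * a i * (1 + j * |t|) :=
            mul_le_mul_of_nonneg_left h (mul_nonneg hk'.le (ha i))
        _ ≤ j * a i * (j * (1 + |t|)) := by
          have := ha i
          gcongr
          nlinarith [abs_nonneg t]
        _ = (1 + |t|) * (j ^ 2 * a i) := by ring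
        _ ≤ _ := by
          refine mul_le_mul_of_nonneg_right ?_ (mul_nonneg (sq_nonneg _) (ha i))
          nlinarith [sq_nonneg t]

/-- Saddle point asymptotics of the coefficient of `z ^ k` in `exp (k * ∑ i, a i * z ^ (i + 1))`
when the saddle point is `z = 1`. -/
theorem tendsto_sqrt_mul_sum_bellTuples {a : ℕ → ℝ} {A v : ℝ} (ha : ∀ i, 0 ≤ a i)
    (ha0 : 0 < a 0) (hA : HasSum a A)
    (h1 : HasSum (fun i : ℕ => ((i + 1 : ℕ) : ℝ) * a i) 1)
    (h2 : HasSum (fun i : ℕ => ((i + 1 : ℕ) : ℝ) ^ 2 * a i) v) :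
    Tendsto (fun k : ℕ => √(k : ℝ) * Real.exp (-(k * A)) *
        ∑ l ∈ bellTuples k, ∏ i : Fin k, (k * a i.1) ^ l i / (Nat.factorial (l i) : ℝ))
      atTop (nhds (1 / √(2 * Real.pi * v))) := by
  have hv : 0 < v := lt_of_lt_of_le ha0 <| by
    simpa using le_hasSum h2 0 fun i _ => mul_nonneg (sq_nonneg _) (ha i)
  have hlim : Tendsto (fun k : ℕ => ∫ t : ℝ,
      (Set.Ioc (-Real.pi * √(k : ℝ)) (Real.pi * √(k : ℝ))).indicator
          (fun t => Complex.exp (saddleExponent a A k (t / √(k : ℝ)))) t) atTop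
      (nhds (∫ t : ℝ, Complex.exp ((-(v / 2) * t ^ 2 : ℝ) : ℂ))) := by
    have hb : 0 < 2 / Real.pi ^ 2 * a 0 := by positivity
    refine tendsto_integral_of_dominated_convergence
      (fun t => Real.exp (-(2 / Real.pi ^ 2 * a 0) * t ^ 2)) (fun k => ?_)
      (integrable_exp_neg_mul_sq hb) (fun k => ae_of_all _ fun t => ?_) (ae_of_all _ fun t => ?_)
    · refine AEStronglyMeasurable.indicator (Continuous.aestronglyMeasurable ?_) measurableSet_Ioc
      unfold saddleExponent
      fun_prop
    · by_cases ht : t ∈ Set.Ioc (-Real.pi * √(k : ℝ)) (Real.pi * √(k : ℝ))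
      · have hs : 0 < √(k : ℝ) := by nlinarith [ht.1, ht.2, Real.pi_pos]
        have hk : 0 < k := Nat.cast_pos.1 (Real.sqrt_pos.1 hs)
        have hφ : |t / √(k : ℝ)| ≤ Real.pi :=
          abs_le.2 ⟨(le_div_iff₀ hs).2 ht.1.le, (div_le_iff₀ hs).2 ht.2⟩
        have := norm_exp_saddleExponent_le ha hA hk hφ
        rwa [div_pow, Real.sq_sqrt k.cast_nonneg, mul_div_cancel₀ _ (Nat.cast_ne_zero.2 hk.ne'),
          ← Set.indicator_of_mem ht fun t => Complex.exp (saddleExponent a A k (t / √(k : ℝ)))]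
          at this
      · rw [Set.indicator_of_notMem ht, norm_zero]
        positivity
    · refine ((Complex.continuous_exp.tendsto _).comp
        (tendsto_saddleExponent ha hA h1 h2 t)).congr' ?_
      have hsq : Tendsto (fun k : ℕ => Real.pi * √(k : ℝ)) atTop atTop :=
        (Real.tendsto_sqrt_atTop.comp tendsto_natCast_atTop_atTop).const_mul_atTop Real.pi_pos
      filter_upwards [hsq.eventually_gt_atTop |t|] with k hk
      have := abs_lt.1 hk
      have ht : t ∈ Set.Ioc (-Real.pi * √(k : ℝ)) (Real.pi * √(k : ℝ)) :=
        ⟨by linarith [this.1], this.2.le⟩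
      exact (Set.indicator_of_mem ht
        fun t => Complex.exp (saddleExponent a A k (t / √(k : ℝ)))).symm
  have hint (k : ℕ) (hk : 0 < k) : ∫ t : ℝ,
      (Set.Ioc (-Real.pi * √(k : ℝ)) (Real.pi * √(k : ℝ))).indicator
        (fun t => Complex.exp (saddleExponent a A k (t / √(k : ℝ)))) t =
      ((2 * Real.pi * (√(k : ℝ) * Real.exp (-(k * A)) *
        ∑ l ∈ bellTuples k, ∏ i : Fin k, (k * a i.1) ^ l i /
          (Nat.factorial (l i) : ℝ)) : ℝ) : ℂ) := by
    have hs : 0 < √(k : ℝ) := Real.sqrt_pos.2 (Nat.cast_pos.2 hk)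
    rw [integral_indicator measurableSet_Ioc, ← intervalIntegral.integral_of_le
      (by nlinarith [Real.pi_pos]),
      intervalIntegral.integral_comp_div (fun φ => Complex.exp (saddleExponent a A k φ)) hs.ne',
      mul_div_cancel_right₀ _ hs.ne', mul_div_cancel_right₀ _ hs.ne']
    have := integral_exp_sum_eq_sum_bellTuples k (fun i => (k * a i.1 : ℂ))
    have hsplit (φ : ℝ) : Complex.exp (saddleExponent a A k φ) = Complex.exp (-(k * A)) *
        Complex.exp (∑ i : Fin k, (k * a i.1 : ℂ) *
          Complex.exp ((i.1 + 1 : ℕ) * φ * Complex.I) - k * φ * Complex.I) := by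
      rw [← Complex.exp_add, saddleExponent, Finset.sum_range]
      congr 1
      ring
    simp_rw [hsplit]
    rw [intervalIntegral.integral_const_mul, this, Complex.real_smul]
    push_cast
    ring
  have hgauss : ∫ t : ℝ, Complex.exp ((-(v / 2) * t ^ 2 : ℝ) : ℂ) =
      ((√(Real.pi / (v / 2)) : ℝ) : ℂ) := by
    rw [← integral_gaussian, ← integral_complex_ofReal]
    simp_rw [Complex.ofReal_exp]
  rw [hgauss] at hlim
  have hreal := ((Complex.continuous_re.tendsto _).comp
    (hlim.congr' ((eventually_gt_atTop 0).mono hint))).const_mul (1 / (2 * Real.pi))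
  have hconst : 1 / √(2 * Real.pi * v) = 1 / (2 * Real.pi) * √(Real.pi / (v / 2)) := by
    have hpi := Real.pi_pos
    rw [div_mul_eq_mul_div, div_eq_div_iff (by positivity) (by positivity), one_mul, one_mul,
      ← Real.sqrt_mul (by positivity), show Real.pi / (v / 2) * (2 * Real.pi * v) =
        (2 * Real.pi) ^ 2 by field_simp, Real.sqrt_sq (by positivity)]
  rw [hconst]
  refine hreal.congr fun k => ?_
  simp only [Function.comp_apply, Complex.ofReal_re]
  field_simp

lemma weightedBell_mul_pow (V : ℕ → ℝ) (χ u : ℝ) (k : ℕ) :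
    weightedBell V k (χ * k) * u ^ k = Nat.factorial k * ∑ l ∈ bellTuples k, ∏ i : Fin k,
      (k * (χ * (V (i.1 + 1) * u ^ (i.1 + 1) / (Nat.factorial (i.1 + 1) : ℝ)))) ^ l i /
        (Nat.factorial (l i) : ℝ) := by
  rw [weightedBell, mul_assoc, Finset.sum_mul]
  congr 1
  refine Finset.sum_congr rfl fun l hl => ?_
  have hk : ∏ i : Fin k, (u ^ (i.1 + 1)) ^ l i = u ^ k := by
    simp_rw [← pow_mul]
    rw [Finset.prod_pow_eq_pow_sum, (Finset.mem_filter.1 hl).2]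
  rw [← hk, ← Finset.prod_mul_distrib]
  refine Finset.prod_congr rfl fun i _ => ?_
  simp only [mul_pow, div_pow]
  field_simp

lemma hasSum_gammaWeight (m χ : ℝ) {s : ℝ} (hs : |s| < 1) :
    HasSum (fun i : ℕ => χ * ((∏ j ∈ Finset.range (i + 1), (m + j)) * s ^ (i + 1) /
      (Nat.factorial (i + 1) : ℝ))) (χ * ((1 - s) ^ (-m) - 1)) := by
  refine HasSum.mul_left χ ?_
  simpa using (hasSum_nat_add_iff' 1).2 (hasSum_risingFactorial m hs)

lemma hasSum_gammaWeight_mul (m χ : ℝ) {s : ℝ} (hs : |s| < 1) :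
    HasSum (fun i : ℕ => ((i + 1 : ℕ) : ℝ) * (χ * ((∏ j ∈ Finset.range (i + 1), (m + j)) *
      s ^ (i + 1) / (Nat.factorial (i + 1) : ℝ)))) (χ * m * s * (1 - s) ^ (-(m + 1))) := by
  convert! (hasSum_risingFactorial (m + 1) hs).mul_left (χ * m * s) using 1
  ext i
  have hi : ((i + 1 : ℕ) : ℝ) ≠ 0 := Nat.cast_ne_zero.2 i.succ_ne_zero
  have hp : ∏ j ∈ Finset.range i, (m + (j + 1 : ℕ)) = ∏ j ∈ Finset.range i, (m + 1 + j) :=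
    Finset.prod_congr rfl fun j _ => by push_cast; ring
  rw [Finset.prod_range_succ', hp, Nat.factorial_succ, Nat.cast_mul]
  field_simp
  push_cast
  ring

lemma hasSum_gammaWeight_mul_sq (m χ : ℝ) {s : ℝ} (hs : |s| < 1) :
    HasSum (fun i : ℕ => ((i + 1 : ℕ) : ℝ) ^ 2 * (χ * ((∏ j ∈ Finset.range (i + 1), (m + j)) *
      s ^ (i + 1) / (Nat.factorial (i + 1) : ℝ))))
      (χ * m * s * (1 - s) ^ (-(m + 1)) +
        χ * m * s * ((m + 1) * s * (1 - s) ^ (-(m + 1 + 1)))) := by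
  have h := (hasSum_gammaWeight_mul (m + 1) 1 hs).mul_left (χ * m * s)
  have h' : HasSum (fun i : ℕ => (i : ℝ) * (((i + 1 : ℕ) : ℝ) *
      (χ * ((∏ j ∈ Finset.range (i + 1), (m + j)) *
        s ^ (i + 1) / (Nat.factorial (i + 1) : ℝ)))))
      (χ * m * s * ((m + 1) * s * (1 - s) ^ (-(m + 1 + 1)))) := by
    rw [← hasSum_nat_add_iff' 1]
    convert! h using 1
    · ext i
      have hi : ((i + 1 : ℕ) : ℝ) ≠ 0 := Nat.cast_ne_zero.2 i.succ_ne_zero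
      have hi' : ((i + 1 + 1 : ℕ) : ℝ) ≠ 0 := Nat.cast_ne_zero.2 (i + 1).succ_ne_zero
      have hp : ∏ j ∈ Finset.range (i + 1), (m + (j + 1 : ℕ)) =
          ∏ j ∈ Finset.range (i + 1), (m + 1 + j) :=
        Finset.prod_congr rfl fun j _ => by push_cast; ring
      rw [Finset.prod_range_succ' _ (i + 1), hp, Nat.factorial_succ (i + 1), Nat.cast_mul]
      field_simp
      push_cast
      ring
    · simp
  convert! (hasSum_gammaWeight_mul m χ hs).add h' using 1
  ext i
  push_cast
  ring

lemma tendsto_factorial_div_stirling :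
    Tendsto (fun k : ℕ => (Nat.factorial k : ℝ) /
      (√(2 * k * Real.pi) * (k / Real.exp 1) ^ k)) atTop (nhds 1) := by
  refine (Asymptotics.isEquivalent_iff_tendsto_one ?_).1 Stirling.factorial_isEquivalent_stirling
  filter_upwards [eventually_gt_atTop 0] with k hk
  have : (0 : ℝ) < k := Nat.cast_pos.2 hk
  positivity

/-- Gamma weights, relation (3.13): sharp asymptotics of `M_k(χ k)` for the
moments `V_j = θ^j m (m+1) ⋯ (m+j−1)` of the gamma law with shape `m` and scale `θ`. -/
theorem stmt12 (m θ : ℝ) (hm : 0 < m) (hθ : 0 < θ) (V : ℕ → ℝ)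
    (hVdef : ∀ j : ℕ, 1 ≤ j → V j = θ ^ j * ∏ i ∈ Finset.range j, (m + i))
    (χ : ℝ) (hχ : 0 < χ)
    (u : ℝ) (hu : 0 < u) (huθ : u < 1 / θ)
    (hLambert : m * θ * u / (1 - θ * u) ^ (m + 1) = 1 / χ) :
    Tendsto (fun k : ℕ => weightedBell V k (χ * k) *
        Real.sqrt ((1 + m * θ * u) / (1 - θ * u)) /
        (((k : ℝ) / (Real.exp 1 * u)) *
          Real.exp ((1 - θ * u) * (1 - (1 - θ * u) ^ m) / (m * θ * u))) ^ k)
      atTop (nhds 1) := by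
  set s : ℝ := θ * u with hs
  have hs0 : 0 < s := mul_pos hθ hu
  have hs1 : s < 1 := by
    have := mul_lt_mul_of_pos_left huθ hθ
    rwa [mul_one_div_cancel hθ.ne'] at this
  have hsabs : |s| < 1 := by rwa [abs_of_pos hs0]
  have h1s : 0 < 1 - s := sub_pos.2 hs1
  have hms : 0 < m * s := mul_pos hm hs0
  have hχs : χ * m * s * (1 - s) ^ (-(m + 1)) = 1 := by
    rw [Real.rpow_neg h1s.le]
    have := Real.rpow_pos_of_pos h1s (m + 1)
    field_simp at hLambert ⊢
    rw [hs]
    linarith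
  have hv : 1 + χ * m * s * ((m + 1) * s * (1 - s) ^ (-(m + 1 + 1))) =
      (1 + m * s) / (1 - s) := by
    rw [show -(m + 1 + 1) = -(m + 1) - 1 by ring, Real.rpow_sub_one h1s.ne',
      show χ * m * s * ((m + 1) * s * ((1 - s) ^ (-(m + 1)) / (1 - s))) =
        (χ * m * s * (1 - s) ^ (-(m + 1))) * ((m + 1) * s) / (1 - s) by ring, hχs]
    field_simp
    ring
  have hA : (1 - s) * (1 - (1 - s) ^ m) / (m * s) = χ * ((1 - s) ^ (-m) - 1) := by
    rw [div_eq_iff hms.ne']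
    have h : (1 - s) ^ (-(m + 1)) = (1 - s) ^ (-m) / (1 - s) := by
      rw [← Real.rpow_sub_one h1s.ne']; ring_nf
    have hpos := Real.rpow_pos_of_pos h1s m
    rw [h, Real.rpow_neg h1s.le] at hχs
    rw [Real.rpow_neg h1s.le]
    field_simp at hχs ⊢
    linear_combination -(1 - (1 - s) ^ m) * hχs
  let a : ℕ → ℝ := fun i => χ * ((∏ j ∈ Finset.range (i + 1), (m + j)) * s ^ (i + 1) /
    (Nat.factorial (i + 1) : ℝ))
  have hapos (i : ℕ) : 0 < a i := by
    have : 0 < ∏ j ∈ Finset.range (i + 1), (m + j) := Finset.prod_pos fun j _ => by positivity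
    positivity
  have h1 := hasSum_gammaWeight_mul m χ hsabs
  have h2 := hasSum_gammaWeight_mul_sq m χ hsabs
  rw [hχs] at h1
  rw [hχs, hv] at h2
  have hmain := tendsto_sqrt_mul_sum_bellTuples (a := a) (fun i => (hapos i).le) (hapos 0)
    (hasSum_gammaWeight m χ hsabs) h1 h2
  have hv0 : 0 < (1 + m * s) / (1 - s) := by positivity
  have hlim := (tendsto_factorial_div_stirling.mul hmain).mul_const
    (√(2 * Real.pi * ((1 + m * s) / (1 - s))))
  have hv1 : √(2 * Real.pi * ((1 + m * s) / (1 - s))) ≠ 0 := by positivity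
  rw [one_mul, one_div_mul_cancel hv1] at hlim
  refine hlim.congr' ?_
  filter_upwards [eventually_gt_atTop 0] with k hk
  have hk' : (0 : ℝ) < k := Nat.cast_pos.2 hk
  have hbell : weightedBell V k (χ * k) * u ^ k = Nat.factorial k * ∑ l ∈ bellTuples k,
      ∏ i : Fin k, (k * a i.1) ^ l i / (Nat.factorial (l i) : ℝ) := by
    have ha (i : ℕ) :
        χ * (V (i + 1) * u ^ (i + 1) / (Nat.factorial (i + 1) : ℝ)) = a i := by
      simp only [a]
      rw [hVdef _ (Nat.le_add_left 1 _), hs, mul_pow]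
      ring
    simp_rw [weightedBell_mul_pow, ha]
  rw [mul_assoc m θ u, ← hs, hA]
  set A : ℝ := χ * ((1 - s) ^ (-m) - 1)
  set B : ℝ := ∑ l ∈ bellTuples k, ∏ i : Fin k, (k * a i.1) ^ l i / (Nat.factorial (l i) : ℝ)
  rw [eq_div_of_mul_eq (pow_pos hu k).ne' hbell]
  have hsq : √(2 * k * Real.pi) * √((1 + m * s) / (1 - s)) =
      √(k : ℝ) * √(2 * Real.pi * ((1 + m * s) / (1 - s))) := by
    rw [← Real.sqrt_mul (by positivity), ← Real.sqrt_mul (by positivity)]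
    congr 1
    ring
  have hexp : Real.exp (-(k * A)) = (Real.exp A ^ k)⁻¹ := by
    rw [Real.exp_neg, Real.exp_nat_mul]
  have hsk : 0 < √(2 * k * Real.pi) := by positivity
  have hX : √((1 + m * s) / (1 - s)) = √(k : ℝ) * √(2 * Real.pi * ((1 + m * s) / (1 - s))) /
      √(2 * k * Real.pi) := by
    rw [← hsq, mul_div_cancel_left₀ _ hsk.ne']
  rw [hX, hexp]
  generalize √(2 * Real.pi * ((1 + m * s) / (1 - s))) = X
  simp only [mul_pow, div_pow]
  field_simp

end
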